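/- arXiv:2103.16834 — 2 statements merged into one kernel-verified Lean document; each statement's English description precedes it below -/
import Mathlib

section
/- Let α ∈ (0,1) and let z ∈ ℂ with Re z > 0. Then the integral ∫_0^∞ (e^{-z r} − 1) r^{−1−α} dr converges and equals Γ(−α) z^α, where z^α is the principal branch of the complex power and Γ is the complex Gamma function. -/
open MeasureTheory Set Real Filter Topology

lemma integrableOn_cexp_neg_mul_rpow {s : ℝ} (hs : -1 < s) {z : ℂ} (hz : 0 < z.re) :
    IntegrableOn (fun t : ℝ => Complex.exp (-z * t) * ((t ^ s : ℝ) : ℂ)) (Ioi 0) := by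
  have hb := integrableOn_rpow_mul_exp_neg_mul_rpow hs one_pos hz
  refine Integrable.mono' hb (by fun_prop) ?_
  filter_upwards [ae_restrict_mem measurableSet_Ioi] with t ht
  rw [norm_mul, Complex.norm_exp, Complex.norm_of_nonneg (rpow_nonneg (le_of_lt ht) s), mul_comm]
  simp

lemma differentiableAt_integral_cexp_neg_mul_rpow {s : ℝ} (hs : -1 < s) {z : ℂ} (hz : 0 < z.re) :
    DifferentiableAt ℂ
      (fun w : ℂ => ∫ t in Ioi (0 : ℝ), Complex.exp (-w * t) * ((t ^ s : ℝ) : ℂ)) z := by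
  have hU : {w : ℂ | z.re / 2 < w.re} ∈ 𝓝 z :=
    (isOpen_lt continuous_const Complex.continuous_re).mem_nhds (half_lt_self hz)
  refine (hasDerivAt_integral_of_dominated_loc_of_deriv_le (𝕜 := ℂ)
    (μ := volume.restrict (Ioi (0 : ℝ)))
    (F := fun (w : ℂ) (t : ℝ) => Complex.exp (-w * t) * ((t ^ s : ℝ) : ℂ))
    (F' := fun (w : ℂ) (t : ℝ) => Complex.exp (-w * t) * (-(t : ℂ)) * ((t ^ s : ℝ) : ℂ))
    (bound := fun t : ℝ => t ^ (s + 1) * Real.exp (-(z.re / 2) * t ^ (1 : ℝ)))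
    hU ?_ (integrableOn_cexp_neg_mul_rpow hs hz) ?_ ?_
    (integrableOn_rpow_mul_exp_neg_mul_rpow (by linarith) one_pos (half_pos hz)) ?_).2
    |>.differentiableAt
  · exact Eventually.of_forall fun w => by fun_prop
  · fun_prop
  · filter_upwards [ae_restrict_mem measurableSet_Ioi] with t (ht : 0 < t) w (hw : _ < _)
    rw [norm_mul, norm_mul, Complex.norm_exp, Complex.norm_of_nonneg (rpow_nonneg ht.le s),
      norm_neg, Complex.norm_of_nonneg ht.le, mul_assoc, rpow_add_one ht.ne', mul_comm t,
      mul_comm (Real.exp _), rpow_one]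
    gcongr
    simp only [Complex.mul_re, Complex.neg_re, Complex.ofReal_re, Complex.ofReal_im, mul_zero,
      sub_zero]
    nlinarith
  · refine Eventually.of_forall fun t w _ => ?_
    refine HasDerivAt.mul_const ?_ _
    simpa using ((hasDerivAt_id w).neg.mul_const (t : ℂ)).cexp

/-- The Gamma integral with a complex rate `z` of positive real part. -/
lemma integral_cexp_neg_mul_rpow {s : ℝ} (hs : 0 < s) {z : ℂ} (hz : 0 < z.re) :
    ∫ t in Ioi (0 : ℝ), Complex.exp (-z * t) * ((t ^ (s - 1) : ℝ) : ℂ) =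
      Complex.Gamma s * z ^ (-(s : ℂ)) := by
  have hopen : IsOpen {w : ℂ | 0 < w.re} := isOpen_lt continuous_const Complex.continuous_re
  have hl : AnalyticOnNhd ℂ
      (fun w : ℂ => ∫ t in Ioi (0 : ℝ), Complex.exp (-w * t) * ((t ^ (s - 1) : ℝ) : ℂ))
      {w | 0 < w.re} :=
    DifferentiableOn.analyticOnNhd (fun w hw =>
      (differentiableAt_integral_cexp_neg_mul_rpow (by linarith) hw).differentiableWithinAt) hopen
  have hr : AnalyticOnNhd ℂ (fun w : ℂ => Complex.Gamma s * w ^ (-(s : ℂ))) {w | 0 < w.re} :=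
    DifferentiableOn.analyticOnNhd (fun w hw =>
      ((differentiableAt_id.cpow_const (Or.inl hw)).const_mul _).differentiableWithinAt) hopen
  refine hl.eqOn_of_preconnected_of_frequently_eq hr
    (convex_halfSpace_re_gt 0).isPreconnected (z₀ := 1) (by simp) ?_ hz
  have ht : Tendsto ((↑) : ℝ → ℂ) (𝓝[≠] 1) (𝓝[≠] 1) := by
    refine tendsto_nhdsWithin_iff.2 ⟨?_, ?_⟩
    · exact (Complex.continuous_ofReal.tendsto' 1 1 (by simp)).mono_left nhdsWithin_le_nhds
    · filter_upwards [self_mem_nhdsWithin] with x hx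
      simpa using hx
  refine ht.frequently (Eventually.frequently ?_)
  filter_upwards [nhdsWithin_le_nhds (Ioi_mem_nhds one_pos)] with x (hx : 0 < x)
  have h := Complex.integral_cpow_mul_exp_neg_mul_Ioi (a := s) (by simpa) hx
  rw [one_div, Complex.inv_cpow _ _ (by simp [Complex.arg_ofReal_of_nonneg hx.le, pi_pos.ne]),
    ← Complex.cpow_neg, mul_comm] at h
  rw [← h]
  refine setIntegral_congr_fun measurableSet_Ioi fun t (ht : 0 < t) => ?_
  simp only [Complex.ofReal_cpow ht.le, neg_mul]
  push_cast
  ring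

lemma norm_cexp_sub_one_le_of_re_nonpos {w : ℂ} (hw : w.re ≤ 0) : ‖Complex.exp w - 1‖ ≤ ‖w‖ := by
  simpa using (convex_halfSpace_re_le 0).norm_image_sub_le_of_norm_hasDerivWithin_le
    (f := Complex.exp) (C := 1) (x := 0) (y := w)
    (fun x _ => (Complex.hasDerivAt_exp x).hasDerivWithinAt)
    (fun x hx => by simpa [Complex.norm_exp] using hx) (by simp) hw

lemma norm_cexp_sub_one_le_two_of_re_nonpos {w : ℂ} (hw : w.re ≤ 0) :
    ‖Complex.exp w - 1‖ ≤ 2 := by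
  have h : ‖Complex.exp w‖ ≤ 1 := by simpa [Complex.norm_exp] using hw
  have := norm_sub_le (Complex.exp w) 1
  rw [norm_one] at this
  linarith

lemma integrableOn_cexp_neg_sub_one_mul_rpow {α : ℝ} (hα : α ∈ Ioo (0 : ℝ) 1) {z : ℂ}
    (hz : 0 ≤ z.re) :
    IntegrableOn (fun r : ℝ => (Complex.exp (-z * r) - 1) * ((r ^ (-1 - α) : ℝ) : ℂ)) (Ioi 0) := by
  have hre {r : ℝ} (hr : 0 < r) : (-z * r).re ≤ 0 := by simpa using mul_nonneg hz hr.le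
  rw [← Ioc_union_Ioi_eq_Ioi zero_le_one]
  refine IntegrableOn.union ?_ ?_
  · have hb : IntegrableOn (fun r : ℝ => ‖z‖ * r ^ (-α)) (Ioc 0 1) :=
      ((intervalIntegrable_iff_integrableOn_Ioc_of_le zero_le_one).1
        (intervalIntegral.intervalIntegrable_rpow' (by linarith [hα.2]))).const_mul _
    refine Integrable.mono' hb (by fun_prop) ?_
    filter_upwards [ae_restrict_mem measurableSet_Ioc] with r ⟨hr, _⟩
    rw [norm_mul, Complex.norm_of_nonneg (rpow_nonneg hr.le _)]
    calc ‖Complex.exp (-z * r) - 1‖ * r ^ (-1 - α) ≤ ‖-z * r‖ * r ^ (-1 - α) := by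
          gcongr
          exact norm_cexp_sub_one_le_of_re_nonpos (hre hr)
      _ = ‖z‖ * r ^ (-α) := by
          rw [norm_mul, norm_neg, Complex.norm_of_nonneg hr.le, mul_assoc, mul_comm r,
            ← rpow_add_one hr.ne']
          ring_nf
  · have hb : IntegrableOn (fun r : ℝ => 2 * r ^ (-1 - α)) (Ioi 1) :=
      (integrableOn_Ioi_rpow_of_lt (by linarith [hα.1]) one_pos).const_mul _
    refine Integrable.mono' hb (by fun_prop) ?_
    filter_upwards [ae_restrict_mem measurableSet_Ioi] with r (hr : 1 < r)
    have hr0 : 0 < r := one_pos.trans hr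
    rw [norm_mul, Complex.norm_of_nonneg (rpow_nonneg hr0.le _)]
    gcongr
    exact norm_cexp_sub_one_le_two_of_re_nonpos (hre hr0)

/-- For `α ∈ (0,1)` and `z ∈ ℂ` with `Re z > 0`, the integral
`∫_0^∞ (e^{-z r} − 1) r^{−1−α} dr` converges and equals `Γ(−α) z^α`,
where `z^α` is the principal branch of the complex power. -/
theorem integral_cexp_neg_sub_one_rpow (α : ℝ) (hα : α ∈ Set.Ioo (0:ℝ) 1)
    (z : ℂ) (hz : 0 < z.re) :
    IntegrableOn (fun r : ℝ => (Complex.exp (-z * r) - 1) * ((r ^ (-1 - α) : ℝ) : ℂ))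
      (Set.Ioi 0) volume ∧
    (∫ r in Set.Ioi (0:ℝ), (Complex.exp (-z * r) - 1) * ((r ^ (-1 - α) : ℝ) : ℂ)) =
      Complex.Gamma (-α) * z ^ (α : ℂ) := by
  have hint := integrableOn_cexp_neg_sub_one_mul_rpow hα hz.le
  refine ⟨hint, ?_⟩
  obtain ⟨h0, h1⟩ := hα
  have hαC : (α : ℂ) ≠ 0 := by exact_mod_cast h0.ne'
  have hzC : z ≠ 0 := fun h => by simp [h] at hz
  have hre {r : ℝ} (hr : 0 < r) : (-z * r).re ≤ 0 := by simpa using mul_nonneg hz.le hr.le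
  set u : ℝ → ℂ := fun r => Complex.exp (-z * r) - 1
  set u' : ℝ → ℂ := fun r => Complex.exp (-z * r) * -z with hu'
  set v : ℝ → ℂ := fun r => ((-α⁻¹ * r ^ (-α) : ℝ) : ℂ) with hv
  set v' : ℝ → ℂ := fun r => ((r ^ (-1 - α) : ℝ) : ℂ)
  have hu'v : u' * v = fun r : ℝ =>
      (z / α) * (Complex.exp (-z * r) * ((r ^ ((1 - α) - 1) : ℝ) : ℂ)) := by
    ext r
    simp only [hu', hv, Pi.mul_apply, sub_sub_cancel_left]
    push_cast
    field_simp
  have hvnorm {r : ℝ} (hr : 0 < r) : ‖v r‖ = α⁻¹ * r ^ (-α) := by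
    rw [hv, Complex.norm_real, neg_mul, norm_neg, Real.norm_of_nonneg (by positivity)]
  have hder := integral_Ioi_mul_deriv_eq_deriv_mul (a := 0) (u := u) (u' := u') (v := v) (v' := v')
    (a' := 0) (b' := 0) ?_ ?_ hint ?_ ?_ ?_
  · change ∫ r in Ioi (0 : ℝ), u r * v' r = _
    have hG := integral_cexp_neg_mul_rpow (s := 1 - α) (by linarith) hz
    change _ = 0 - 0 - ∫ r in Ioi (0 : ℝ), (u' * v) r at hder
    have hΓ := Complex.Gamma_add_one (-(α : ℂ)) (neg_ne_zero.2 hαC)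
    have hpow : z ^ (α : ℂ) = z * z ^ (-((1 - α : ℝ) : ℂ)) := by
      nth_rewrite 2 [← Complex.cpow_one z]
      rw [← Complex.cpow_add _ _ hzC]
      push_cast
      ring_nf
    rw [hder, hu'v, integral_const_mul, hG, hpow]
    push_cast
    rw [show (1 - α : ℂ) = -α + 1 by ring, hΓ]
    field_simp
    ring
  · intro r _
    refine HasDerivAt.sub_const _ ?_
    simpa [hu'] using ((Complex.ofRealCLM.hasDerivAt (x := r)).const_mul (-z)).cexp
  · intro r (hr : 0 < r)
    refine HasDerivAt.ofReal_comp ?_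
    refine ((Real.hasDerivAt_rpow_const (p := -α) (Or.inl hr.ne')).const_mul (-α⁻¹)).congr_deriv ?_
    rw [show -α - 1 = -1 - α by ring]
    field_simp
  · rw [hu'v]
    exact (integrableOn_cexp_neg_mul_rpow (by linarith) hz).const_mul _
  · have hlim : Tendsto (fun r : ℝ => ‖z‖ * α⁻¹ * r ^ (1 - α)) (𝓝[>] 0) (𝓝 0) := by
      have := (Real.continuousAt_rpow_const 0 (1 - α) (Or.inr (by linarith))).tendsto.const_mul
        (‖z‖ * α⁻¹)
      rw [zero_rpow (by linarith), mul_zero] at this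
      exact this.mono_left nhdsWithin_le_nhds
    refine squeeze_zero_norm' ?_ hlim
    filter_upwards [self_mem_nhdsWithin] with r (hr : 0 < r)
    rw [Pi.mul_apply, norm_mul, hvnorm hr]
    calc ‖u r‖ * (α⁻¹ * r ^ (-α)) ≤ ‖-z * r‖ * (α⁻¹ * r ^ (-α)) := by
          gcongr
          exact norm_cexp_sub_one_le_of_re_nonpos (hre hr)
      _ = ‖z‖ * α⁻¹ * r ^ (1 - α) := by
          rw [norm_mul, norm_neg, Complex.norm_of_nonneg hr.le, sub_eq_neg_add,
            rpow_add_one hr.ne']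
          ring
  · have hlim : Tendsto (fun r : ℝ => 2 * (α⁻¹ * r ^ (-α))) atTop (𝓝 0) := by
      simpa using ((tendsto_rpow_neg_atTop h0).const_mul α⁻¹).const_mul 2
    refine squeeze_zero_norm' ?_ hlim
    filter_upwards [eventually_gt_atTop 0] with r hr
    rw [Pi.mul_apply, norm_mul, hvnorm hr]
    gcongr
    exact norm_cexp_sub_one_le_two_of_re_nonpos (hre hr)
end

section
/- Let α ∈ (0,2) and λ > 0, and define the tempered stable symbol ψ(m) = ∫_{ℝ \ {0}} (cos(m y) − 1) e^{−λ|y|} |y|^{−1−α} dy for m ∈ ℝ. Then ψ(m) is finite for every m, and there exist constants c₁, c₂, C > 0 such that for all m ∈ ℝ: −c₂ |m|^α ≤ ψ(m) ≤ −c₁ |m|^α + C. -/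
open MeasureTheory Set Real

lemma integrable_one_sub_cos_mul_abs_rpow {α : ℝ} (hα : α ∈ Set.Ioo (0 : ℝ) 2) :
    Integrable (fun y : ℝ => (1 - Real.cos y) * |y| ^ (-1 - α)) := by
  obtain ⟨h0, h2⟩ := hα
  have hmeas : Measurable (fun y : ℝ => (1 - Real.cos y) * |y| ^ (-1 - α)) := by fun_prop
  have hIoc : IntegrableOn (fun y : ℝ => (1 - Real.cos y) * |y| ^ (-1 - α)) (Ioc 0 1) := by
    have hbase : IntegrableOn (fun y : ℝ => y ^ (1 - α)) (Ioc 0 1) := by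
      rw [← intervalIntegrable_iff_integrableOn_Ioc_of_le zero_le_one]
      exact intervalIntegral.intervalIntegrable_rpow' (by linarith)
    refine hbase.mono' hmeas.aestronglyMeasurable ?_
    filter_upwards [ae_restrict_mem measurableSet_Ioc] with y hy
    have hcos : 1 - Real.cos y ≤ y ^ 2 := by
      nlinarith [Real.one_sub_sq_div_two_le_cos (x := y)]
    have hsplit : y ^ (1 - α) = y ^ 2 * y ^ (-1 - α) := by
      rw [← Real.rpow_natCast, ← Real.rpow_add hy.1]
      congr 1
      push_cast
      ring
    rw [abs_of_pos hy.1, Real.norm_of_nonneg (mul_nonneg (by linarith [Real.cos_le_one y])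
      (Real.rpow_nonneg hy.1.le _)), hsplit]
    exact mul_le_mul_of_nonneg_right hcos (Real.rpow_nonneg hy.1.le _)
  have hIoi : IntegrableOn (fun y : ℝ => (1 - Real.cos y) * |y| ^ (-1 - α)) (Ioi 1) := by
    have hbase : IntegrableOn (fun y : ℝ => 2 * y ^ (-1 - α)) (Ioi 1) :=
      (integrableOn_Ioi_rpow_of_lt (by linarith) one_pos).const_mul 2
    refine hbase.mono' hmeas.aestronglyMeasurable ?_
    filter_upwards [ae_restrict_mem measurableSet_Ioi] with y hy
    have hy0 : 0 < y := one_pos.trans hy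
    rw [abs_of_pos hy0, Real.norm_of_nonneg (mul_nonneg (by linarith [Real.cos_le_one y])
      (Real.rpow_nonneg hy0.le _))]
    exact mul_le_mul_of_nonneg_right (by linarith [Real.neg_one_le_cos y])
      (Real.rpow_nonneg hy0.le _)
  have hpos := hIoc.union hIoi
  rw [Ioc_union_Ioi_eq_Ioi zero_le_one] at hpos
  have hneg : IntegrableOn (fun y : ℝ => (1 - Real.cos y) * |y| ^ (-1 - α)) (Iic 0) := by
    rw [← neg_zero, ← integrableOn_Ici_iff_integrableOn_Ioi] at hpos
    simpa using hpos.comp_neg_Iic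
  rw [← integrableOn_univ, ← Iic_union_Ioi (a := (0 : ℝ))]
  exact hneg.union hpos

lemma one_sub_cos_mul_mul_abs_rpow (α : ℝ) {m : ℝ} (hm : m ≠ 0) (y : ℝ) :
    (1 - Real.cos (m * y)) * |y| ^ (-1 - α) =
      |m| ^ (1 + α) * ((1 - Real.cos (m * y)) * |m * y| ^ (-1 - α)) := by
  have h : |m| ^ (1 + α) * |m| ^ (-1 - α) = 1 := by
    rw [← Real.rpow_add (abs_pos.2 hm), show 1 + α + (-1 - α) = 0 by ring, Real.rpow_zero]
  rw [abs_mul, Real.mul_rpow (abs_nonneg _) (abs_nonneg _)]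
  linear_combination -((1 - Real.cos (m * y)) * |y| ^ (-1 - α)) * h

lemma integrable_one_sub_cos_mul_mul_abs_rpow {α : ℝ} (hα : α ∈ Set.Ioo (0 : ℝ) 2) (m : ℝ) :
    Integrable (fun y : ℝ => (1 - Real.cos (m * y)) * |y| ^ (-1 - α)) := by
  rcases eq_or_ne m 0 with rfl | hm
  · simp
  simp_rw [one_sub_cos_mul_mul_abs_rpow α hm]
  exact ((integrable_one_sub_cos_mul_abs_rpow hα).comp_mul_left' hm).const_mul _

lemma integral_one_sub_cos_mul_mul_abs_rpow {α : ℝ} (hα : 0 < α) (m : ℝ) :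
    ∫ y : ℝ, (1 - Real.cos (m * y)) * |y| ^ (-1 - α) =
      |m| ^ α * ∫ y : ℝ, (1 - Real.cos y) * |y| ^ (-1 - α) := by
  rcases eq_or_ne m 0 with rfl | hm
  · simp [Real.zero_rpow hα.ne']
  simp_rw [one_sub_cos_mul_mul_abs_rpow α hm]
  rw [integral_const_mul, Measure.integral_comp_mul_left
    (fun y : ℝ => (1 - Real.cos y) * |y| ^ (-1 - α)), smul_eq_mul, ← mul_assoc, abs_inv,
    Real.rpow_add (abs_pos.2 hm), Real.rpow_one]
  have := abs_ne_zero.2 hm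
  field_simp

section Tempered

variable {α lam : ℝ}

lemma exp_neg_mul_abs_le_one (hlam : 0 < lam) (y : ℝ) : Real.exp (-lam * |y|) ≤ 1 :=
  Real.exp_le_one_iff.2 (by nlinarith [abs_nonneg y])

lemma tempered_stable_integrand_nonneg (α lam m y : ℝ) :
    0 ≤ (1 - Real.cos (m * y)) * (Real.exp (-lam * |y|) * |y| ^ (-1 - α)) :=
  mul_nonneg (by linarith [Real.cos_le_one (m * y)])
    (mul_nonneg (Real.exp_pos _).le (Real.rpow_nonneg (abs_nonneg _) _))

lemma tempered_stable_integrand_le (hlam : 0 < lam) (m y : ℝ) :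
    (1 - Real.cos (m * y)) * (Real.exp (-lam * |y|) * |y| ^ (-1 - α)) ≤
      (1 - Real.cos (m * y)) * |y| ^ (-1 - α) :=
  mul_le_mul_of_nonneg_left
    (mul_le_of_le_one_left (Real.rpow_nonneg (abs_nonneg _) _) (exp_neg_mul_abs_le_one hlam y))
    (by linarith [Real.cos_le_one (m * y)])

lemma integrable_tempered_stable_integrand (hα : α ∈ Set.Ioo (0 : ℝ) 2) (hlam : 0 < lam) (m : ℝ) :
    Integrable (fun y : ℝ =>
      (1 - Real.cos (m * y)) * (Real.exp (-lam * |y|) * |y| ^ (-1 - α))) := by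
  refine (integrable_one_sub_cos_mul_mul_abs_rpow hα m).mono'
    (Measurable.aestronglyMeasurable (by fun_prop)) (.of_forall fun y => ?_)
  rw [Real.norm_of_nonneg (tempered_stable_integrand_nonneg α lam m y)]
  exact tempered_stable_integrand_le hlam m y

lemma integral_tempered_stable_integrand_le (hα : α ∈ Set.Ioo (0 : ℝ) 2) (hlam : 0 < lam) (m : ℝ) :
    ∫ y : ℝ, (1 - Real.cos (m * y)) * (Real.exp (-lam * |y|) * |y| ^ (-1 - α)) ≤
      |m| ^ α * ∫ y : ℝ, (1 - Real.cos y) * |y| ^ (-1 - α) := by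
  rw [← integral_one_sub_cos_mul_mul_abs_rpow hα.1]
  exact integral_mono (integrable_tempered_stable_integrand hα hlam m)
    (integrable_one_sub_cos_mul_mul_abs_rpow hα m) (tempered_stable_integrand_le hlam m)

/-- The integrand is bounded below on the interval `[1 / (2|m|), 1 / |m|]`. -/
lemma le_integral_tempered_stable_integrand (hα : α ∈ Set.Ioo (0 : ℝ) 2) (hlam : 0 < lam)
    {m : ℝ} (hm : 1 ≤ |m|) :
    (1 - Real.cos (1 / 2)) * Real.exp (-lam) / 2 * |m| ^ α ≤
      ∫ y : ℝ, (1 - Real.cos (m * y)) * (Real.exp (-lam * |y|) * |y| ^ (-1 - α)) := by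
  have hm0 : 0 < |m| := one_pos.trans_le hm
  have hintegrable := integrable_tempered_stable_integrand hα hlam m
  have hbound : ∀ y ∈ Icc (1 / (2 * |m|)) (1 / |m|),
      (1 - Real.cos (1 / 2)) * (Real.exp (-lam) * |m| ^ (1 + α)) ≤
        (1 - Real.cos (m * y)) * (Real.exp (-lam * |y|) * |y| ^ (-1 - α)) := by
    rintro y ⟨hy1, hy2⟩
    have hy0 : 0 < y := lt_of_lt_of_le (by positivity) hy1
    have hlow : 1 / 2 ≤ |m| * y := by
      rw [div_le_iff₀ (by positivity)] at hy1
      linarith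
    have hupp : |m| * y ≤ 1 := by
      rw [le_div_iff₀ hm0] at hy2
      linarith
    have hy1' : y ≤ 1 := by nlinarith
    have hcos : Real.cos (m * y) ≤ Real.cos (1 / 2) := by
      rw [← Real.cos_abs (m * y), abs_mul, abs_of_pos hy0]
      exact Real.cos_le_cos_of_nonneg_of_le_pi (by norm_num)
        (by linarith [Real.pi_gt_three]) hlow
    have hrpow : |m| ^ (1 + α) ≤ y ^ (-1 - α) := by
      rw [show -1 - α = -(1 + α) by ring, Real.rpow_neg hy0.le, ← Real.inv_rpow hy0.le]
      refine Real.rpow_le_rpow hm0.le ?_ (by linarith [hα.1])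
      rw [le_inv_comm₀ hm0 hy0, ← one_div]
      exact hy2
    rw [abs_of_pos hy0]
    refine mul_le_mul (by linarith) (mul_le_mul (Real.exp_le_exp.2 (by nlinarith)) hrpow
      (by positivity) (by positivity)) (by positivity) (by linarith [Real.cos_le_one (m * y)])
  have hle : 1 / (2 * |m|) ≤ 1 / |m| := one_div_le_one_div_of_le hm0 (by linarith)
  calc (1 - Real.cos (1 / 2)) * Real.exp (-lam) / 2 * |m| ^ α
      = (1 - Real.cos (1 / 2)) * (Real.exp (-lam) * |m| ^ (1 + α)) *
          volume.real (Icc (1 / (2 * |m|)) (1 / |m|)) := by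
        rw [Real.volume_real_Icc_of_le hle, Real.rpow_add hm0, Real.rpow_one]
        field_simp
        ring
    _ ≤ ∫ y in Icc (1 / (2 * |m|)) (1 / |m|),
          (1 - Real.cos (m * y)) * (Real.exp (-lam * |y|) * |y| ^ (-1 - α)) :=
        setIntegral_ge_of_const_le_real measurableSet_Icc measure_Icc_lt_top.ne hbound
          hintegrable.integrableOn
    _ ≤ _ := setIntegral_le_integral hintegrable
        (.of_forall (tempered_stable_integrand_nonneg α lam m))

end Tempered

/-- For `α ∈ (0,2)` and `λ > 0`, the tempered stable symbol
`ψ(m) = ∫_{ℝ\{0}} (cos(m y) − 1) e^{−λ|y|} |y|^{−1−α} dy` is finite for every `m`, and there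
are constants `c₁, c₂, C > 0` with `−c₂|m|^α ≤ ψ(m) ≤ −c₁|m|^α + C` for all `m`. -/
theorem tempered_stable_symbol_bounds (α lam : ℝ) (hα : α ∈ Set.Ioo (0:ℝ) 2) (hlam : 0 < lam) :
    (∀ m : ℝ, IntegrableOn
      (fun y : ℝ => (Real.cos (m * y) - 1) * (Real.exp (-lam * |y|) * |y| ^ (-1 - α)))
      {y : ℝ | y ≠ 0} volume) ∧
    (∃ c₁ > (0:ℝ), ∃ c₂ > (0:ℝ), ∃ C > (0:ℝ), ∀ m : ℝ,
      -c₂ * |m| ^ α ≤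
        (∫ y in {y : ℝ | y ≠ 0},
          (Real.cos (m * y) - 1) * (Real.exp (-lam * |y|) * |y| ^ (-1 - α))) ∧
      (∫ y in {y : ℝ | y ≠ 0},
          (Real.cos (m * y) - 1) * (Real.exp (-lam * |y|) * |y| ^ (-1 - α))) ≤
        -c₁ * |m| ^ α + C) := by
  have hneg (m y : ℝ) : (Real.cos (m * y) - 1) * (Real.exp (-lam * |y|) * |y| ^ (-1 - α)) =
      -((1 - Real.cos (m * y)) * (Real.exp (-lam * |y|) * |y| ^ (-1 - α))) := by ring
  have hset : volume.restrict {y : ℝ | y ≠ 0} = volume := restrict_compl_singleton 0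
  simp only [IntegrableOn, hset, hneg, integral_neg]
  refine ⟨fun m => (integrable_tempered_stable_integrand hα hlam m).neg, ?_⟩
  have hcos : Real.cos (1 / 2) < 1 := by
    simpa using Real.cos_lt_cos_of_nonneg_of_le_pi (x := 0) (y := 1 / 2) le_rfl
      (by linarith [Real.pi_gt_three]) (by norm_num)
  have hc : 0 < (1 - Real.cos (1 / 2)) * Real.exp (-lam) / 2 :=
    div_pos (mul_pos (by linarith) (Real.exp_pos _)) two_pos
  have hG : 0 ≤ ∫ y : ℝ, (1 - Real.cos y) * |y| ^ (-1 - α) :=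
    integral_nonneg fun y => mul_nonneg (by linarith [Real.cos_le_one y])
      (Real.rpow_nonneg (abs_nonneg _) _)
  refine ⟨_, hc, (∫ y : ℝ, (1 - Real.cos y) * |y| ^ (-1 - α)) + 1, by linarith, _, hc,
    fun m => ⟨?_, ?_⟩⟩
  · have hle := integral_tempered_stable_integrand_le hα hlam m
    linarith [Real.rpow_nonneg (abs_nonneg m) α]
  · rcases le_total 1 |m| with hm | hm
    · linarith [le_integral_tempered_stable_integrand hα hlam hm]
    · have hpow := Real.rpow_le_one (abs_nonneg m) hm hα.1.le
      have hnonneg := integral_nonneg (μ := volume) (f := fun y : ℝ =>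
        (1 - Real.cos (m * y)) * (Real.exp (-lam * |y|) * |y| ^ (-1 - α)))
        (tempered_stable_integrand_nonneg α lam m)
      nlinarith
end
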